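/- arXiv:2605.06533 — 10 statements merged into one kernel-verified Lean document; each statement's English description precedes it below -/
import Mathlib

section
/- Let B and B' be complete atomic Boolean algebras and let f : B → B' be a monotone map that preserves all suprema and all infima. Let g : B' → B be a left adjoint of f, i.e., g and f form a Galois connection (g b' ≤ b ↔ b' ≤ f b for all b, b'). Then g maps atoms to atoms: if a is an atom of B', then g a is an atom of B. -/
/-- the left adjoint of a complete lattice homomorphism between
CABAs maps atoms to atoms. -/
theorem left_adjoint_maps_atoms_to_atoms
    {B B' : Type*} [CompleteAtomicBooleanAlgebra B] [CompleteAtomicBooleanAlgebra B']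
    (f : B → B') (hmono : Monotone f)
    (hsup : ∀ s : Set B, f (sSup s) = sSup (f '' s))
    (hinf : ∀ s : Set B, f (sInf s) = sInf (f '' s))
    (g : B' → B) (hadj : ∀ (b : B) (b' : B'), g b' ≤ b ↔ b' ≤ f b)
    {a : B'} (ha : IsAtom a) : IsAtom (g a) := by
  have hbot : f ⊥ = ⊥ := by simpa using hsup ∅
  have htop : f ⊤ = ⊤ := by simpa using hinf ∅
  refine ⟨fun h => ha.1 ?_, fun x hx => ?_⟩
  · have h1 := (hadj ⊥ a).1 h.le
    rw [hbot] at h1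
    exact le_bot_iff.1 h1
  · have hn : ¬ a ≤ f x := fun h => hx.not_ge ((hadj x a).2 h)
    have hd : Disjoint a (f x) := ha.not_le_iff_disjoint.1 hn
    have hs : f x ⊔ f xᶜ = ⊤ := by
      have h2 := hsup {x, xᶜ}
      rw [Set.image_pair, sSup_pair, sSup_pair, sup_compl_eq_top, htop] at h2
      exact h2.symm
    have hc : a ≤ f xᶜ := hd.left_le_of_le_sup_left (hs ▸ le_top)
    have h3 : x ≤ xᶜ := hx.le.trans ((hadj xᶜ a).2 hc)
    exact le_compl_self.1 h3
end

section
/- The lower lifting is full: if Q : Set X → Set Y → Prop is a directionally atomic relation between the powerset complete atomic Boolean algebras Set X and Set Y, then Q = Lower S, where S : X → Y → Prop is defined by S x y ↔ Q {x} {y}. -/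
universe u

/-- A relation between preorders is a bimodule if it is down-closed on the left
and up-closed on the right. -/
def Bimodule {B B' : Type*} [Preorder B] [Preorder B'] (Q : B → B' → Prop) : Prop :=
  ∀ ⦃b₁' b₁ : B⦄ ⦃b₂ b₂' : B'⦄, b₁' ≤ b₁ → Q b₁ b₂ → b₂ ≤ b₂' → Q b₁' b₂'

/-- A relation is left-disjunctive if it is closed under arbitrary joins on the
left.  (Indexing over `Type u`, the universe of `B`, loses no generality, since
any indexed join equals the join over its range.) -/
def LeftDisjunctive {B : Type u} {B' : Type*} [CompleteLattice B] [Preorder B']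
    (Q : B → B' → Prop) : Prop :=
  ∀ {ι : Type u} (a : ι → B) (b : B'), (∀ i, Q (a i) b) → Q (⨆ i, a i) b

/-- A relation is atomic-founded if every atom related to `b` is related to some
atom below `b`. -/
def AtomicFounded {B B' : Type*} [PartialOrder B] [OrderBot B] [PartialOrder B'] [OrderBot B']
    (Q : B → B' → Prop) : Prop :=
  ∀ ⦃a : B⦄ ⦃b : B'⦄, IsAtom a → Q a b → ∃ b', IsAtom b' ∧ b' ≤ b ∧ Q a b'

/-- A relation between CABAs is directionally atomic if it is a bimodule,
left-disjunctive, and atomic-founded. -/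
def DirectionallyAtomic {B : Type u} {B' : Type*} [CompleteAtomicBooleanAlgebra B]
    [CompleteAtomicBooleanAlgebra B'] (Q : B → B' → Prop) : Prop :=
  Bimodule Q ∧ LeftDisjunctive Q ∧ AtomicFounded Q

/-- Relational composition. -/
def RComp {A B C : Type*} (R : A → B → Prop) (S : B → C → Prop) (a : A) (c : C) : Prop :=
  ∃ b, R a b ∧ S b c

/-- The lower lifting of a relation to powersets. -/
def Lower {X Y : Type*} (R : X → Y → Prop) (S : Set X) (T : Set Y) : Prop :=
  ∀ s ∈ S, ∃ t ∈ T, R s t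

/-- the lower lifting is full: every directionally atomic relation
between powerset CABAs is the lower lifting of its restriction to singletons. -/
theorem lower_full {X Y : Type*} (Q : Set X → Set Y → Prop)
    (hQ : DirectionallyAtomic Q) :
    Q = Lower (fun x y => Q {x} {y}) := by
  obtain ⟨hb, hl, ha⟩ := hQ
  funext S T
  apply propext
  constructor
  · intro h s hs
    have h1 : Q {s} T := hb (Set.singleton_subset_iff.mpr hs) h le_rfl
    obtain ⟨b', hat, hle, hq⟩ := ha (Set.isAtom_singleton s) h1
    obtain ⟨t, rfl⟩ := Set.isAtom_iff.mp hat
    exact ⟨t, hle rfl, hq⟩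
  · intro h
    have h1 : Q (⨆ i : S, ({(i : X)} : Set X)) T := by
      apply hl
      rintro ⟨s, hs⟩
      obtain ⟨t, ht, hq⟩ := h s hs
      exact hb le_rfl hq (Set.singleton_subset_iff.mpr ht)
    refine hb ?_ h1 le_rfl
    intro x hx
    exact Set.mem_iUnion.mpr ⟨⟨x, hx⟩, rfl⟩
end

section
/- Let B and B' be complete atomic Boolean algebras, let f : B → B' be a monotone map preserving all suprema and all infima, and let g : B' → B be its left adjoint (g b' ≤ b ↔ b' ≤ f b). Then the relation j f : B → B' → Prop defined by (j f) b b' ↔ b ≤ g b' is directionally atomic. -/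
universe u

/-- the relation `j f` induced by a morphism of CABAs `f` (with left
adjoint `g`) is directionally atomic. -/
theorem j_directionallyAtomic
    {B B' : Type*} [CompleteAtomicBooleanAlgebra B] [CompleteAtomicBooleanAlgebra B']
    (f : B → B') (hmono : Monotone f)
    (hsup : ∀ s : Set B, f (sSup s) = sSup (f '' s))
    (hinf : ∀ s : Set B, f (sInf s) = sInf (f '' s))
    (g : B' → B) (hadj : ∀ (b : B) (b' : B'), g b' ≤ b ↔ b' ≤ f b) :
    DirectionallyAtomic (fun (b : B) (b' : B') => b ≤ g b') := by
  have gc : GaloisConnection g f := fun b' b => hadj b b'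
  refine ⟨fun b₁' b₁ b₂ b₂' h₁ h h₂ => h₁.trans (h.trans (gc.monotone_l h₂)),
    fun a b h => iSup_le h, ?_⟩
  intro a b ha hab
  by_contra hcon
  have hb : b ≤ f aᶜ := by
    rw [le_iff_atom_le_imp]
    intro c hc hcb
    rw [← hadj]
    have hn : ¬ a ≤ g c := fun h => hcon ⟨c, hc, hcb, h⟩
    exact (ha.not_le_iff_disjoint.1 hn).symm.le_compl_right
  have h1 : a ≤ aᶜ := le_trans hab ((hadj _ _).2 hb)
  exact ha.1 (le_compl_self.1 h1)
end

section
/- Let (X, R) and (Y, S) be Kripke frames and Q : X → Y → Prop a relation. The following are equivalent: (i) Q is a simulation; (ii) for all A : Set X and B : Set Y, Lower Q A B implies Lower Q (◇_R A) (◇_S B); (iii) for all A : Set X and B : Set Y, Lower Q A (□_S B) implies Lower Q (◇_R A) B. -/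
/-- The possibility operator `◇_R` on the powerset of a Kripke frame `(X, R)`. -/
def dia {X : Type*} (R : X → X → Prop) (A : Set X) : Set X := {w | ∃ v ∈ A, R v w}

/-- The necessity operator `□_R` on the powerset of a Kripke frame `(X, R)`. -/
def box {X : Type*} (R : X → X → Prop) (A : Set X) : Set X := {w | ∀ v, R w v → v ∈ A}

/-- A simulation between Kripke frames `(X, R)` and `(Y, S)`. -/
def Simulation {X Y : Type*} (R : X → X → Prop) (S : Y → Y → Prop) (Q : X → Y → Prop) : Prop :=
  ∀ ⦃x y x'⦄, Q x y → R x x' → ∃ y', S y y' ∧ Q x' y'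

/-- characterisation of simulations via the lower lifting. -/
theorem simulation_tfae {X Y : Type*} (R : X → X → Prop) (S : Y → Y → Prop)
    (Q : X → Y → Prop) :
    [Simulation R S Q,
     ∀ (A : Set X) (B : Set Y), Lower Q A B → Lower Q (dia R A) (dia S B),
     ∀ (A : Set X) (B : Set Y), Lower Q A (box S B) → Lower Q (dia R A) B].TFAE := by
  tfae_have 1 → 2 := by
    rintro h A B hAB x' ⟨x, hx, hR⟩
    obtain ⟨y, hy, hQ⟩ := hAB x hx
    obtain ⟨y', hS, hQ'⟩ := h hQ hR
    exact ⟨y', ⟨y, hy, hS⟩, hQ'⟩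
  tfae_have 2 → 3 := by
    intro h A B hAB x' hx'
    obtain ⟨y', ⟨y, hy, hS⟩, hQ'⟩ := h A (box S B) hAB x' hx'
    exact ⟨y', hy y' hS, hQ'⟩
  tfae_have 3 → 1 := by
    intro h x y x' hQ hR
    have hL : Lower Q {x} (box S {y' | S y y'}) := by
      rintro z rfl
      exact ⟨y, fun v hv => hv, hQ⟩
    obtain ⟨y', hy', hQ'⟩ := h _ _ hL x' ⟨x, rfl, hR⟩
    exact ⟨y', hy', hQ'⟩
  tfae_finish
end

section
/- Let (B,◇,□), (B',◇',□'), (B'',◇'',□'') be complete atomic Boolean algebras each equipped with a Galois connection ◇ ⊣ □ of maps on itself. If Q : B → B' → Prop and S : B' → B'' → Prop are directionally atomic and simulatory, then their composite (Q ; S) c, defined by (Q ; S) a c ↔ ∃ b, Q a b ∧ S b c, is simulatory: (Q ; S) a (□'' c) implies (Q ; S) (◇ a) c. -/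
universe u

/-- simulatory directionally atomic relations between CABAOs compose. -/
theorem rcomp_simulatory
    {B B' B'' : Type*} [CompleteAtomicBooleanAlgebra B] [CompleteAtomicBooleanAlgebra B']
    [CompleteAtomicBooleanAlgebra B'']
    (dia : B → B) (box : B → B) (hgc : GaloisConnection dia box)
    (dia' : B' → B') (box' : B' → B') (hgc' : GaloisConnection dia' box')
    (dia'' : B'' → B'') (box'' : B'' → B'') (hgc'' : GaloisConnection dia'' box'')
    (Q : B → B' → Prop) (S : B' → B'' → Prop)
    (hQda : DirectionallyAtomic Q) (hSda : DirectionallyAtomic S)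
    (hQsim : ∀ a b, Q a (box' b) → Q (dia a) b)
    (hSsim : ∀ a b, S a (box'' b) → S (dia' a) b) :
    ∀ a c, RComp Q S a (box'' c) → RComp Q S (dia a) c := by
  rintro a c ⟨b, hQ, hS⟩
  exact ⟨dia' b, hQsim a _ (hQda.1 le_rfl hQ (hgc'.le_u_l b)), hSsim b c hS⟩
end

section
/- Let (X, R) and (Y, S) be Kripke frames. If Q : Set X → Set Y → Prop is a directionally atomic relation between the powerset CABAs which is simulatory with respect to the operators (◇_R, □_R) and (◇_S, □_S) (i.e., Q A (□_S B) implies Q (◇_R A) B), then the relation T : X → Y → Prop defined by T x y ↔ Q {x} {y} is a simulation between (X,R) and (Y,S), and Q = Lower T. -/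
universe u

/-- every simulatory directionally atomic relation between the
powerset CABAOs of two Kripke frames is the lower lifting of a simulation. -/
theorem lower_sim_full {X Y : Type*} (R : X → X → Prop) (S : Y → Y → Prop)
    (Q : Set X → Set Y → Prop) (hda : DirectionallyAtomic Q)
    (hsim : ∀ (A : Set X) (B : Set Y), Q A (box S B) → Q (dia R A) B) :
    Simulation R S (fun x y => Q {x} {y}) ∧ Q = Lower (fun x y => Q {x} {y}) := by
  obtain ⟨hb, hl, ha⟩ := hda
  have key : ∀ x B, Q {x} B → ∃ y ∈ B, Q {x} {y} := by
    intro x B h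
    obtain ⟨b', h1, h2, h3⟩ := ha (Set.isAtom_singleton x) h
    obtain ⟨y, rfl⟩ := Set.isAtom_iff.1 h1
    exact ⟨y, h2 rfl, h3⟩
  refine ⟨?_, ?_⟩
  · intro x y x' h hR
    have h1 : Q (dia R {x}) {y' | S y y'} := by
      apply hsim
      refine hb le_rfl h ?_
      rintro _ rfl v hv
      exact hv
    have h2 : Q {x'} {y' | S y y'} := by
      refine hb ?_ h1 le_rfl
      rintro _ rfl
      exact ⟨x, rfl, hR⟩
    exact key _ _ h2
  · funext A B
    apply propext
    constructor
    · intro h x hx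
      exact key x B (hb (Set.singleton_subset_iff.2 hx) h le_rfl)
    · intro h
      have h1 := hl (fun i : A => ({(i : X)} : Set X)) B (by
        rintro ⟨x, hx⟩
        obtain ⟨y, hy, hq⟩ := h x hx
        exact hb le_rfl hq (Set.singleton_subset_iff.2 hy))
      refine hb ?_ h1 le_rfl
      intro x hx
      exact Set.mem_iUnion.2 ⟨⟨x, hx⟩, rfl⟩
end

section
/- The variant construction is a contravariant involutive equivalence on directionally atomic relations between complete atomic Boolean algebras: (1) if Q : B → B' → Prop is directionally atomic, then Variant Q : B' → B → Prop is directionally atomic; (2) Variant (Variant Q) = Q for directionally atomic Q; (3) Variant of the order relation ≤ on B equals ≤ on B; and (4) for directionally atomic Q : B → B' → Prop and S : B' → B'' → Prop, Variant (Q ; S) = (Variant S) ; (Variant Q), where (R ; S) a c ↔ ∃ b, R a b ∧ S b c. -/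
universe u

/-- The variant of a relation between CABAs. -/
def Variant {B B' : Type*} [CompleteAtomicBooleanAlgebra B] [CompleteAtomicBooleanAlgebra B']
    (Q : B → B' → Prop) (b' : B') (b : B) : Prop :=
  ∀ a' : B', IsAtom a' → a' ≤ b' → ∃ a : B, IsAtom a ∧ a ≤ b ∧ Q a a'

theorem atom_le_iSup_aux {B : Type*} [CompleteAtomicBooleanAlgebra B] {ι : Sort*}
    {a : B} (ha : IsAtom a) (f : ι → B) (h : a ≤ ⨆ i, f i) : ∃ i, a ≤ f i := by
  by_contra hn
  push Not at hn
  have h2 : a ⊓ ⨆ i, f i = ⊥ := by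
    rw [inf_iSup_eq]
    simp only [iSup_eq_bot]
    intro i
    exact (ha.le_iff.1 inf_le_left).resolve_right (fun he => hn i (inf_eq_left.1 he))
  rw [inf_eq_left.2 h] at h2
  exact ha.1 h2

theorem da_iff_aux {B B' : Type*} [CompleteAtomicBooleanAlgebra B]
    [CompleteAtomicBooleanAlgebra B'] {Q : B → B' → Prop} (hQ : DirectionallyAtomic Q)
    (b : B) (c : B') : Q b c ↔ ∀ a, IsAtom a → a ≤ b → Q a c := by
  constructor
  · intro h a _ hab
    exact hQ.1 hab h le_rfl
  · intro h
    have h1 := hQ.2.1 (fun i : {a : B // IsAtom a ∧ a ≤ b} => i.1) c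
      (fun i => h i.1 i.2.1 i.2.2)
    refine hQ.1 ?_ h1 le_rfl
    rw [le_iff_atom_le_imp]
    intro a ha hab
    exact le_iSup (fun i : {a : B // IsAtom a ∧ a ≤ b} => i.1) ⟨a, ha, hab⟩

theorem atom_eq_aux {B : Type*} [PartialOrder B] [OrderBot B] {a b : B} (ha : IsAtom a)
    (hb : IsAtom b) (h : a ≤ b) : a = b :=
  (hb.le_iff.1 h).resolve_left ha.1

theorem variant_da_aux {B B' : Type*} [CompleteAtomicBooleanAlgebra B]
    [CompleteAtomicBooleanAlgebra B'] (Q : B → B' → Prop) :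
    DirectionallyAtomic (Variant Q) := by
  refine ⟨?_, ?_, ?_⟩
  · intro b₁' b₁ b₂ b₂' h1 h h2 a' ha' hle
    obtain ⟨a, ha, hab, hq⟩ := h a' ha' (hle.trans h1)
    exact ⟨a, ha, hab.trans h2, hq⟩
  · intro ι f b h a' ha' hle
    obtain ⟨i, hi⟩ := atom_le_iSup_aux ha' f hle
    exact h i a' ha' hi
  · intro a' b ha' h
    obtain ⟨a, ha, hab, hq⟩ := h a' ha' le_rfl
    refine ⟨a, ha, hab, ?_⟩
    intro x hx hxa
    rw [atom_eq_aux hx ha' hxa]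
    exact ⟨a, ha, le_rfl, hq⟩

/-- the variant construction is a contravariant involutive
equivalence on directionally atomic relations. -/
theorem variant_involutive_equivalence
    {B B' B'' : Type*} [CompleteAtomicBooleanAlgebra B] [CompleteAtomicBooleanAlgebra B']
    [CompleteAtomicBooleanAlgebra B''] :
    (∀ Q : B → B' → Prop, DirectionallyAtomic Q → DirectionallyAtomic (Variant Q)) ∧
    (∀ Q : B → B' → Prop, DirectionallyAtomic Q → Variant (Variant Q) = Q) ∧
    (Variant (fun a b : B => a ≤ b) = fun a b : B => a ≤ b) ∧
    (∀ (Q : B → B' → Prop) (S : B' → B'' → Prop),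
      DirectionallyAtomic Q → DirectionallyAtomic S →
      Variant (RComp Q S) = RComp (Variant S) (Variant Q)) := by
  refine ⟨fun Q _ => variant_da_aux Q, ?_, ?_, ?_⟩
  · intro Q hQ
    funext b c
    apply propext
    rw [da_iff_aux hQ b c]
    constructor
    · intro h a ha hab
      obtain ⟨a', ha', hc, hv⟩ := h a ha hab
      obtain ⟨x, hx, hxa, hq⟩ := hv a' ha' le_rfl
      rw [atom_eq_aux hx ha hxa] at hq
      exact hQ.1 le_rfl hq hc
    · intro h a ha hab
      obtain ⟨a', ha', hc, hq⟩ := hQ.2.2 ha (h a ha hab)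
      refine ⟨a', ha', hc, ?_⟩
      intro x hx hxa
      rw [atom_eq_aux hx ha' hxa]
      exact ⟨a, ha, le_rfl, hq⟩
  · funext b c
    apply propext
    rw [le_iff_atom_le_imp]
    constructor
    · intro h a ha hab
      obtain ⟨x, hx, hxc, hxa⟩ := h a ha hab
      rwa [← atom_eq_aux hx ha hxa]
    · intro h a ha hab
      exact ⟨a, ha, h a ha hab, le_rfl⟩
  · intro Q S hQ hS
    funext c a
    apply propext
    constructor
    · intro h
      refine ⟨⨆ i : {b : B' // IsAtom b ∧ ∃ x, IsAtom x ∧ x ≤ a ∧ Q x b}, i.1, ?_, ?_⟩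
      · intro c' hc' hle
        obtain ⟨x, hx, hxa, b, hxb, hbc⟩ := h c' hc' hle
        obtain ⟨b', hb', hb'b, hxb'⟩ := hQ.2.2 hx hxb
        exact ⟨b', hb', le_iSup
          (fun i : {b : B' // IsAtom b ∧ ∃ x, IsAtom x ∧ x ≤ a ∧ Q x b} => i.1)
          ⟨b', hb', x, hx, hxa, hxb'⟩, hS.1 hb'b hbc le_rfl⟩
      · intro b' hb' hle
        obtain ⟨⟨b, hb, hex⟩, hi⟩ := atom_le_iSup_aux hb' _ hle
        rw [atom_eq_aux hb' hb hi]
        exact hex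
    · rintro ⟨b, hcb, hba⟩ c' hc' hle
      obtain ⟨b', hb', hb'b, hs⟩ := hcb c' hc' hle
      obtain ⟨x, hx, hxa, hq⟩ := hba b' hb' hb'b
      exact ⟨x, hx, hxa, b', hq, hs⟩
end

section
/- Let (X, R) and (Y, S) be Kripke frames and Q : X → Y → Prop a relation. The following are equivalent: (i) Q is a cosimulation (i.e., Q x y and S y y' imply ∃ x', R x x' ∧ Q x' y'); (ii) for all B : Set Y and A : Set X, Variant (Lower Q) B A implies Variant (Lower Q) (◇_S B) (◇_R A); (iii) for all B : Set Y and A : Set X, Variant (Lower Q) B (□_R A) implies Variant (Lower Q) (◇_S B) A. -/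
/-- A cosimulation between Kripke frames `(X, R)` and `(Y, S)`. -/
def Cosimulation {X Y : Type*} (R : X → X → Prop) (S : Y → Y → Prop) (Q : X → Y → Prop) : Prop :=
  ∀ ⦃x y y'⦄, Q x y → S y y' → ∃ x', R x x' ∧ Q x' y'

theorem variant_lower_iff_aux {X Y : Type*} (Q : X → Y → Prop) (B : Set Y) (A : Set X) :
    Variant (Lower Q) B A ↔ ∀ y ∈ B, ∃ x ∈ A, Q x y := by
  constructor
  · intro h y hy
    obtain ⟨a, ha, hle, hq⟩ := h {y} (Set.isAtom_singleton y) (Set.singleton_subset_iff.2 hy)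
    obtain ⟨x, rfl⟩ := Set.isAtom_iff.1 ha
    obtain ⟨t, ht, hxt⟩ := hq x rfl
    obtain rfl : t = y := ht
    exact ⟨x, hle rfl, hxt⟩
  · intro h a' ha' hle
    obtain ⟨y, rfl⟩ := Set.isAtom_iff.1 ha'
    obtain ⟨x, hx, hq⟩ := h y (hle rfl)
    refine ⟨{x}, Set.isAtom_singleton x, Set.singleton_subset_iff.2 hx, ?_⟩
    rintro s rfl
    exact ⟨y, rfl, hq⟩

/-- characterisation of cosimulations via the variant of the lower
lifting. -/
theorem cosimulation_tfae {X Y : Type*} (R : X → X → Prop) (S : Y → Y → Prop)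
    (Q : X → Y → Prop) :
    [Cosimulation R S Q,
     ∀ (B : Set Y) (A : Set X),
       Variant (Lower Q) B A → Variant (Lower Q) (dia S B) (dia R A),
     ∀ (B : Set Y) (A : Set X),
       Variant (Lower Q) B (box R A) → Variant (Lower Q) (dia S B) A].TFAE := by
  simp only [variant_lower_iff_aux]
  tfae_have 1 → 2 := by
    rintro h B A hBA y' ⟨y, hy, hS⟩
    obtain ⟨x, hx, hq⟩ := hBA y hy
    obtain ⟨x', hR, hq'⟩ := h hq hS
    exact ⟨x', ⟨x, hx, hR⟩, hq'⟩
  tfae_have 2 → 3 := by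
    intro h B A hBA y' hy'
    obtain ⟨x', ⟨x, hx, hR⟩, hq⟩ := h B _ hBA y' hy'
    exact ⟨x', hx x' hR, hq⟩
  tfae_have 3 → 1 := by
    intro h x y y' hq hS
    obtain ⟨x', hx', hq'⟩ := h {y} {x' | R x x'}
      (by rintro z rfl; exact ⟨x, fun v hv => hv, hq⟩) y' ⟨y, rfl, hS⟩
    exact ⟨x', hx', hq'⟩
  tfae_finish
end

section
/- Let (B,◇,□), (B',◇',□'), (B'',◇'',□'') be complete atomic Boolean algebras each equipped with a Galois connection ◇ ⊣ □ of maps on itself. If Q : B → B' → Prop and S : B' → B'' → Prop are directionally atomic and cosimulatory, then their composite (Q ; S), defined by (Q ; S) a c ↔ ∃ b, Q a b ∧ S b c, is cosimulatory: Variant (Q ; S) c (□ a) implies Variant (Q ; S) (◇'' c) a. -/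
universe u

/-- cosimulatory directionally atomic relations between CABAOs
compose. -/
theorem rcomp_cosimulatory
    {B B' B'' : Type*} [CompleteAtomicBooleanAlgebra B] [CompleteAtomicBooleanAlgebra B']
    [CompleteAtomicBooleanAlgebra B'']
    (dia : B → B) (box : B → B) (hgc : GaloisConnection dia box)
    (dia' : B' → B') (box' : B' → B') (hgc' : GaloisConnection dia' box')
    (dia'' : B'' → B'') (box'' : B'' → B'') (hgc'' : GaloisConnection dia'' box'')
    (Q : B → B' → Prop) (S : B' → B'' → Prop)
    (hQda : DirectionallyAtomic Q) (hSda : DirectionallyAtomic S)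
    (hQcosim : ∀ b' b, Variant Q b' (box b) → Variant Q (dia' b') b)
    (hScosim : ∀ b'' b', Variant S b'' (box' b') → Variant S (dia'' b'') b') :
    ∀ c a, Variant (RComp Q S) c (box a) → Variant (RComp Q S) (dia'' c) a := by
  intro c a h
  set m : B' := sSup {b' | IsAtom b' ∧ ∃ x, IsAtom x ∧ x ≤ box a ∧ Q x b'} with hm
  have h1 : Variant Q m (box a) := by
    intro b' hb' hle
    obtain ⟨y, ⟨hy, x, hx, hxa, hQ⟩, hby⟩ := (hb'.le_sSup).1 hle
    exact ⟨x, hx, hxa, ((hy.le_iff_eq hb'.1).1 hby) ▸ hQ⟩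
  have h2 := hQcosim _ _ h1
  have h3 : Variant S c (box' (dia' m)) := by
    intro c' hc' hle
    obtain ⟨x, hx, hxa, b, hQ, hS⟩ := h c' hc' hle
    obtain ⟨b', hb', hbb, hQ'⟩ := hQda.2.2 hx hQ
    exact ⟨b', hb', (le_sSup ⟨hb', x, hx, hxa, hQ'⟩ : b' ≤ m).trans (hgc'.le_u_l m),
      hSda.1 hbb hS le_rfl⟩
  intro c' hc' hle
  obtain ⟨b', hb', hbm, hS⟩ := hScosim _ _ h3 c' hc' hle
  obtain ⟨x, hx, hxa, hQ⟩ := h2 b' hb' hbm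
  exact ⟨x, hx, hxa, b', hQ, hS⟩
end

section
/- Let (X, R) and (Y, S) be Kripke frames. If Q : Set X → Set Y → Prop is a directionally atomic relation between the powerset CABAs which is both simulatory (Q A (□_S B) implies Q (◇_R A) B) and cosimulatory (Variant Q B (□_R A) implies Variant Q (◇_S B) A), then the relation T : X → Y → Prop defined by T x y ↔ Q {x} {y} is a bisimulation between (X,R) and (Y,S), and Q = Lower T. -/
universe u

/-- A bisimulation is a simulation which is also a cosimulation. -/
def Bisimulation {X Y : Type*} (R : X → X → Prop) (S : Y → Y → Prop)
    (Q : X → Y → Prop) : Prop :=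
  Simulation R S Q ∧ Cosimulation R S Q

/-- every bisimulatory directionally atomic relation between the
powerset CABAOs of two Kripke frames is the lower lifting of a bisimulation. -/
theorem lower_bisim_full {X Y : Type*} (R : X → X → Prop) (S : Y → Y → Prop)
    (Q : Set X → Set Y → Prop) (hda : DirectionallyAtomic Q)
    (hsim : ∀ (A : Set X) (B : Set Y), Q A (box S B) → Q (dia R A) B)
    (hcosim : ∀ (B : Set Y) (A : Set X),
      Variant Q B (box R A) → Variant Q (dia S B) A) :
    Bisimulation R S (fun x y => Q {x} {y}) ∧ Q = Lower (fun x y => Q {x} {y}) := by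
  obtain ⟨hb, hl, ha⟩ := hda
  have key : ∀ (x : X) (B : Set Y), Q {x} B → ∃ y ∈ B, Q {x} {y} := by
    intro x B h
    obtain ⟨b, hb1, hb2, hb3⟩ := ha (Set.isAtom_singleton x) h
    obtain ⟨y, rfl⟩ := Set.isAtom_iff.1 hb1
    exact ⟨y, hb2 rfl, hb3⟩
  refine ⟨⟨?_, ?_⟩, ?_⟩
  · intro x y x' h hR
    have h1 : Q {x} (box S {z | S y z}) := by
      refine hb le_rfl h ?_
      rintro _ rfl
      exact fun v hv => hv
    have h2 := hsim _ _ h1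
    have h3 : Q {x'} {z | S y z} := by
      refine hb ?_ h2 le_rfl
      rintro _ rfl
      exact ⟨x, rfl, hR⟩
    exact key _ _ h3
  · intro x y y' h hS
    have h1 : Variant Q {y} (box R {z | R x z}) := by
      intro a' ha' hle
      obtain ⟨w, rfl⟩ := Set.isAtom_iff.1 ha'
      have hw : w = y := hle rfl
      subst hw
      refine ⟨{x}, Set.isAtom_singleton x, ?_, h⟩
      rintro _ rfl
      exact fun v hv => hv
    obtain ⟨a, ha1, ha2, ha3⟩ := hcosim _ _ h1 {y'} (Set.isAtom_singleton y') (by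
      rintro _ rfl
      exact ⟨y, rfl, hS⟩)
    obtain ⟨x', rfl⟩ := Set.isAtom_iff.1 ha1
    exact ⟨x', ha2 rfl, ha3⟩
  · funext A B
    apply propext
    constructor
    · intro h s hs
      exact key _ _ (hb (Set.singleton_subset_iff.2 hs) h le_rfl)
    · intro h
      have h1 := hl (fun i : A => ({(i : X)} : Set X)) B (by
        rintro ⟨s, hs⟩
        obtain ⟨t, ht, hq⟩ := h s hs
        exact hb le_rfl hq (Set.singleton_subset_iff.2 ht))
      refine hb ?_ h1 le_rfl
      intro s hs
      exact Set.mem_iUnion.2 ⟨⟨s, hs⟩, rfl⟩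
end
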